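/- arXiv:1806.07757 — 6 statements merged into one kernel-verified Lean document; each statement's English description precedes it below -/
import Mathlib

section
/- Let α be a finite type and let f : Finset α → ℝ be nonnegative, monotone, and submodular. Define the greedy sequence S₀ = ∅ and S_{i+1} = S_i ∪ {x_{i+1}}, where x_{i+1} is an element maximizing f(S_i ∪ {x}) over all x ∈ α. Then for every k, f(S_k) ≥ (1 − 1/e) · max{f(T) : T ⊆ α, |T| = k}. -/
/-- A set function on finite subsets of `α` is submodular if marginal gains diminish. -/
def Submodular {α : Type*} [DecidableEq α] (f : Finset α → ℝ) : Prop :=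
  ∀ A B : Finset α, A ⊆ B → ∀ x, x ∉ B →
    f (insert x B) - f B ≤ f (insert x A) - f A

/-- The gain from adding a set `T` to `A` is at most the sum of the gains of its elements. -/
theorem Submodular.union_le_add_sum {α : Type*} [DecidableEq α] {f : Finset α → ℝ}
    (hmono : ∀ A B : Finset α, A ⊆ B → f A ≤ f B) (hsub : Submodular f) (A T : Finset α) :
    f (A ∪ T) ≤ f A + ∑ y ∈ T, (f (insert y A) - f A) := by
  induction T using Finset.induction_on with
  | empty => simp
  | insert y T hy ih =>
    rw [Finset.sum_insert hy, Finset.union_insert]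
    by_cases h : y ∈ A ∪ T
    · rw [Finset.insert_eq_of_mem h]
      linarith [hmono A (insert y A) (Finset.subset_insert y A)]
    · linarith [hsub A (A ∪ T) Finset.subset_union_left y h]

/-- If `x` has the largest marginal gain over `A`, then `card T` times that gain bounds the
gap between `f T` and `f A`. -/
theorem Submodular.sub_le_card_mul {α : Type*} [DecidableEq α] {f : Finset α → ℝ}
    (hmono : ∀ A B : Finset α, A ⊆ B → f A ≤ f B) (hsub : Submodular f) {A : Finset α} {x : α}
    (hx : ∀ y : α, f (insert y A) ≤ f (insert x A)) (T : Finset α) :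
    f T - f A ≤ T.card * (f (insert x A) - f A) := by
  have hsum : ∑ y ∈ T, (f (insert y A) - f A) ≤ T.card * (f (insert x A) - f A) := by
    rw [← nsmul_eq_mul]
    exact Finset.sum_le_card_nsmul _ _ _ fun y _ => sub_le_sub_right (hx y) _
  linarith [hmono T (A ∪ T) Finset.subset_union_right, hsub.union_le_add_sum hmono A T]

/-- Greedy maximization of a nonnegative monotone submodular function achieves a
`(1 - 1/e)` approximation of the optimum over sets of each cardinality `k`. -/
theorem greedy_submodular_approx {α : Type*} [Fintype α] [DecidableEq α]
    (f : Finset α → ℝ)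
    (hnonneg : ∀ S : Finset α, 0 ≤ f S)
    (hmono : ∀ A B : Finset α, A ⊆ B → f A ≤ f B)
    (hsub : Submodular f)
    (S : ℕ → Finset α)
    (hS0 : S 0 = ∅)
    (hgreedy : ∀ i : ℕ, ∃ x : α,
      S (i + 1) = insert x (S i) ∧ ∀ y : α, f (insert y (S i)) ≤ f (insert x (S i))) :
    ∀ (k : ℕ) (T : Finset α), T.card = k →
      (1 - 1 / Real.exp 1) * f T ≤ f (S k) := by
  intro k T hT
  rcases Nat.eq_zero_or_pos k with rfl | hk
  · rw [Finset.card_eq_zero.mp hT, hS0]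
    have : 0 ≤ 1 / Real.exp 1 * f ∅ := mul_nonneg (by positivity) (hnonneg _)
    linarith
  have hk1 : (1 : ℝ) ≤ k := by exact_mod_cast hk
  have hk0 : (0 : ℝ) < k := by linarith
  have hratio : 0 ≤ 1 - 1 / (k : ℝ) := sub_nonneg.mpr ((div_le_one hk0).mpr hk1)
  have hgap : ∀ i : ℕ, f T - f (S i) ≤ (1 - 1 / (k : ℝ)) ^ i * f T := by
    intro i
    induction i with
    | zero => simpa using hnonneg (S 0)
    | succ i ih =>
      obtain ⟨x, hxS, hx⟩ := hgreedy i
      have hstep := hsub.sub_le_card_mul hmono hx T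
      rw [← hxS, hT, mul_comm, ← div_le_iff₀ hk0] at hstep
      calc f T - f (S (i + 1))
          ≤ (f T - f (S i)) - (f T - f (S i)) / k := by linarith
        _ = (1 - 1 / (k : ℝ)) * (f T - f (S i)) := by ring
        _ ≤ (1 - 1 / (k : ℝ)) * ((1 - 1 / (k : ℝ)) ^ i * f T) :=
          mul_le_mul_of_nonneg_left ih hratio
        _ = (1 - 1 / (k : ℝ)) ^ (i + 1) * f T := by ring
  have hexp : (1 - 1 / (k : ℝ)) ^ k ≤ 1 / Real.exp 1 := by
    rw [one_div (Real.exp 1), ← Real.exp_neg]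
    exact Real.one_sub_div_pow_le_exp_neg hk1
  linarith [hgap k, mul_le_mul_of_nonneg_right hexp (hnonneg T)]
end

section
/- Let V be a finite set of vertices, E ⊆ V × V a set of directed edges, and p : E → [0,1]. Then the Independent Cascade influence spread σ_p : Finset V → ℝ, defined by σ_p(S) = ∑_{H ⊆ E} w_p(H) · |R_H(S)|, is a nonnegative, monotone, and submodular function of the seed set S. -/
open scoped Classical

/-- The probability weight of a live-edge graph `H ⊆ E` under edge probabilities `p`. -/
noncomputable def liveEdgeWeight {V : Type*} [DecidableEq V]
    (E : Finset (V × V)) (p : V × V → ℝ) (H : Finset (V × V)) : ℝ :=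
  (∏ e ∈ H, p e) * ∏ e ∈ E \ H, (1 - p e)

/-- The set of vertices reachable from the seed set `S` using only the edges of `H`,
counted as a finset. -/
noncomputable def reachSet {V : Type*} [Fintype V]
    (H : Finset (V × V)) (S : Finset V) : Finset V :=
  Finset.univ.filter
    (fun v => ∃ s ∈ S, Relation.ReflTransGen (fun a b => (a, b) ∈ H) s v)

/-- The Independent Cascade influence spread of a seed set `S`. -/
noncomputable def icSpread {V : Type*} [Fintype V] [DecidableEq V]
    (E : Finset (V × V)) (p : V × V → ℝ) (S : Finset V) : ℝ :=
  ∑ H ∈ E.powerset, liveEdgeWeight E p H * ((reachSet H S).card : ℝ)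

theorem liveEdgeWeight_nonneg {V : Type*} [DecidableEq V] {E : Finset (V × V)}
    {p : V × V → ℝ} (hp0 : ∀ e ∈ E, 0 ≤ p e) (hp1 : ∀ e ∈ E, p e ≤ 1)
    {H : Finset (V × V)} (hH : H ⊆ E) : 0 ≤ liveEdgeWeight E p H :=
  mul_nonneg (Finset.prod_nonneg fun e he => hp0 e (hH he))
    (Finset.prod_nonneg fun e he => sub_nonneg.2 (hp1 e (Finset.mem_sdiff.1 he).1))

theorem reachSet_mono {V : Type*} [Fintype V] (H : Finset (V × V)) {A B : Finset V}
    (hAB : A ⊆ B) : reachSet H A ⊆ reachSet H B :=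
  Finset.monotone_filter_right _ fun _ _ ⟨s, hs, h⟩ => ⟨s, hAB hs, h⟩

theorem reachSet_insert {V : Type*} [Fintype V] [DecidableEq V] (H : Finset (V × V))
    (x : V) (S : Finset V) :
    reachSet H (insert x S) = reachSet H S ∪ reachSet H {x} := by
  ext v
  simp [reachSet, or_comm]

theorem submodular_card_reachSet {V : Type*} [Fintype V] [DecidableEq V]
    (H : Finset (V × V)) : Submodular fun S : Finset V => ((reachSet H S).card : ℝ) := by
  intro A B hAB x _
  have marginal (S : Finset V) :
      ((reachSet H (insert x S)).card : ℝ) - (reachSet H S).card =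
        (reachSet H {x} \ reachSet H S).card := by
    rw [reachSet_insert, Finset.union_comm, ← Finset.card_sdiff_add_card]
    push_cast
    ring
  simp only [marginal]
  exact_mod_cast Finset.card_le_card (Finset.sdiff_subset_sdiff subset_rfl (reachSet_mono H hAB))

/-- The Independent Cascade influence spread is nonnegative, monotone and submodular
in the seed set. -/
theorem icSpread_nonneg_monotone_submodular {V : Type*} [Fintype V] [DecidableEq V]
    (E : Finset (V × V)) (p : V × V → ℝ)
    (hp0 : ∀ e ∈ E, 0 ≤ p e) (hp1 : ∀ e ∈ E, p e ≤ 1) :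
    (∀ S : Finset V, 0 ≤ icSpread E p S) ∧
    (∀ A B : Finset V, A ⊆ B → icSpread E p A ≤ icSpread E p B) ∧
    Submodular (icSpread E p) := by
  have hw {H : Finset (V × V)} (hH : H ∈ E.powerset) : 0 ≤ liveEdgeWeight E p H :=
    liveEdgeWeight_nonneg hp0 hp1 (Finset.mem_powerset.1 hH)
  refine ⟨fun S => Finset.sum_nonneg fun H hH => mul_nonneg (hw hH) (Nat.cast_nonneg _),
    fun A B hAB => Finset.sum_le_sum fun H hH => mul_le_mul_of_nonneg_left
      (mod_cast Finset.card_le_card (reachSet_mono H hAB)) (hw hH), fun A B hAB x hx => ?_⟩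
  simp only [icSpread, ← Finset.sum_sub_distrib, ← mul_sub]
  exact Finset.sum_le_sum fun H hH =>
    mul_le_mul_of_nonneg_left (submodular_card_reachSet H A B hAB x hx) (hw hH)
end

section
/- Let V be a finite set of vertices and E ⊆ V × V a set of directed edges. For each vertex v let q_v be a probability distribution over subsets of the in-neighborhood {u : (u,v) ∈ E} (so q_v(T) ≥ 0 for each such subset T and ∑_T q_v(T) = 1). For a choice T = (T_v)_{v ∈ V} of one triggering set per vertex, say that edge (u,v) is live if u ∈ T_v, and let R_T(S) be the set of vertices reachable from S via live edges. Then the Triggering model influence spread σ(S) = ∑_{T} (∏_{v ∈ V} q_v(T_v)) · |R_T(S)|, summed over all choices T, is a nonnegative, monotone, and submodular function of S. -/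
open scoped Classical

/-- The vertices reachable from `S` via live edges, where edge `(u,v)` is live iff
`u` belongs to the triggering set `T v`. -/
noncomputable def triggerReach {V : Type*} [Fintype V]
    (T : V → Finset V) (S : Finset V) : Finset V :=
  Finset.univ.filter
    (fun v => ∃ s ∈ S, Relation.ReflTransGen (fun a b => a ∈ T b) s v)

/-- The Triggering model influence spread: the expected number of vertices reachable
from `S` via live edges, when each vertex `v` independently draws its triggering set
`T v` with probability `q v (T v)`. -/
noncomputable def triggerSpread {V : Type*} [Fintype V] [DecidableEq V]
    (q : V → Finset V → ℝ) (S : Finset V) : ℝ :=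
  ∑ T : V → Finset V, (∏ v : V, q v (T v)) * ((triggerReach T S).card : ℝ)

theorem mem_triggerReach {V : Type*} [Fintype V] {T : V → Finset V} {S : Finset V} {v : V} :
    v ∈ triggerReach T S ↔ ∃ s ∈ S, Relation.ReflTransGen (fun a b => a ∈ T b) s v := by
  simp [triggerReach]

theorem triggerReach_mono {V : Type*} [Fintype V] (T : V → Finset V) :
    Monotone (triggerReach T) := fun _ _ hAB _ hv =>
  let ⟨s, hs, h⟩ := mem_triggerReach.1 hv
  mem_triggerReach.2 ⟨s, hAB hs, h⟩

theorem triggerReach_insert {V : Type*} [Fintype V] [DecidableEq V]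
    (T : V → Finset V) (x : V) (S : Finset V) :
    triggerReach T (insert x S) = triggerReach T {x} ∪ triggerReach T S := by
  ext v
  simp [mem_triggerReach]

theorem card_triggerReach_insert {V : Type*} [Fintype V] [DecidableEq V]
    (T : V → Finset V) (x : V) (S : Finset V) :
    (triggerReach T (insert x S)).card =
      (triggerReach T {x} \ triggerReach T S).card + (triggerReach T S).card := by
  rw [triggerReach_insert, Finset.card_sdiff_add_card]

theorem submodular_card_triggerReach {V : Type*} [Fintype V] [DecidableEq V]
    (T : V → Finset V) : Submodular fun S => ((triggerReach T S).card : ℝ) := by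
  intro A B hAB x _
  simp only [card_triggerReach_insert, Nat.cast_add, add_sub_cancel_right, Nat.cast_le]
  exact Finset.card_le_card (Finset.sdiff_subset_sdiff subset_rfl (triggerReach_mono T hAB))

/-- In the Triggering model, where each `q v` is a probability distribution supported on
subsets of the in-neighborhood of `v`, the influence spread is nonnegative,
monotone and submodular in the seed set. -/
theorem triggerSpread_nonneg_monotone_submodular {V : Type*} [Fintype V] [DecidableEq V]
    (E : Finset (V × V)) (q : V → Finset V → ℝ)
    (hq0 : ∀ v (T : Finset V), 0 ≤ q v T)
    (hsupp : ∀ v (T : Finset V), q v T ≠ 0 → ∀ u ∈ T, (u, v) ∈ E)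
    (hsum : ∀ v, ∑ T ∈ (Finset.univ.filter fun u => (u, v) ∈ E).powerset, q v T = 1) :
    (∀ S : Finset V, 0 ≤ triggerSpread q S) ∧
    (∀ A B : Finset V, A ⊆ B → triggerSpread q A ≤ triggerSpread q B) ∧
    Submodular (triggerSpread q) := by
  have hw (T : V → Finset V) : 0 ≤ ∏ v, q v (T v) := Finset.prod_nonneg fun v _ => hq0 v (T v)
  refine ⟨fun S => Finset.sum_nonneg fun T _ => mul_nonneg (hw T) (Nat.cast_nonneg _),
    fun A B hAB => Finset.sum_le_sum fun T _ => mul_le_mul_of_nonneg_left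
      (Nat.cast_le.2 (Finset.card_le_card (triggerReach_mono T hAB))) (hw T),
    fun A B hAB x hx => ?_⟩
  simp only [triggerSpread, ← Finset.sum_sub_distrib, ← mul_sub]
  exact Finset.sum_le_sum fun T _ =>
    mul_le_mul_of_nonneg_left (submodular_card_triggerReach T A B hAB x hx) (hw T)
end

section
/- Let V be a finite set with |V| = n, E ⊆ V × V a set of directed edges, and p : E → [0,1] edge weights satisfying ∑_{u : (u,v) ∈ E} p(u,v) ≤ 1 for every v ∈ V. For thresholds θ : V → [0,1] and seed set S ⊆ V define the Linear Threshold dynamics A₀(S,θ) = S and A_{t+1}(S,θ) = A_t(S,θ) ∪ {v : ∑_{u ∈ A_t(S,θ), (u,v) ∈ E} p(u,v) ≥ θ(v)}, and let the final active set be A_n(S,θ). Define σ_LT(S) = ∫ |A_n(S,θ)| dθ, where θ is distributed as the product over v ∈ V of the uniform distribution on [0,1]. Then σ_LT is a monotone and submodular function of S. -/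
open scoped Classical
open MeasureTheory

section Activation

variable {V : Type*} [Fintype V]

/-- The smallest set containing `S` which is closed under the activation rule `G`, where `G v X`
says that `v` becomes active as soon as all vertices of `X` are. -/
noncomputable def activationClosure (G : V → Finset V → Prop) (S : Finset V) : Finset V :=
  Finset.univ.filter fun x =>
    ∀ X : Finset V, S ⊆ X → (∀ v, G v X → v ∈ X) → x ∈ X

theorem mem_activationClosure {G : V → Finset V → Prop} {S : Finset V} {x : V} :
    x ∈ activationClosure G S ↔
      ∀ X : Finset V, S ⊆ X → (∀ v, G v X → v ∈ X) → x ∈ X := by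
  simp [activationClosure]

theorem subset_activationClosure (G : V → Finset V → Prop) (S : Finset V) :
    S ⊆ activationClosure G S :=
  fun _ hx => mem_activationClosure.2 fun _ hS _ => hS hx

theorem activationClosure_subset {G : V → Finset V → Prop} {S X : Finset V} (hS : S ⊆ X)
    (hX : ∀ v, G v X → v ∈ X) : activationClosure G S ⊆ X :=
  fun _ hx => mem_activationClosure.1 hx X hS hX

theorem mem_activationClosure_of_rule {G : V → Finset V → Prop} (hG : ∀ v, Monotone (G v))
    (S : Finset V) (v : V) (hv : G v (activationClosure G S)) : v ∈ activationClosure G S :=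
  mem_activationClosure.2 fun _ hS hX => hX v (hG v (activationClosure_subset hS hX) hv)

theorem activationClosure_mono (G : V → Finset V → Prop) {S T : Finset V} (h : S ⊆ T) :
    activationClosure G S ⊆ activationClosure G T :=
  fun _ hx => mem_activationClosure.2 fun X hT hX =>
    mem_activationClosure.1 hx X (h.trans hT) hX

theorem activationClosure_mono_rule {G H : V → Finset V → Prop} (h : ∀ v X, G v X → H v X)
    (S : Finset V) : activationClosure G S ⊆ activationClosure H S :=
  fun _ hx => mem_activationClosure.2 fun X hS hX =>
    mem_activationClosure.1 hx X hS fun v hv => hX v (h v X hv)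

/-- The step-by-step activation process reaches the closure after `Fintype.card V` steps. -/
theorem eq_activationClosure_of_step {G : V → Finset V → Prop} (hG : ∀ v, Monotone (G v))
    {A : ℕ → Finset V} (hA : ∀ t v, v ∈ A (t + 1) ↔ v ∈ A t ∨ G v (A t)) :
    A (Fintype.card V) = activationClosure G (A 0) := by
  have hsucc (t : ℕ) : A t ⊆ A (t + 1) := fun v hv => (hA t v).2 (Or.inl hv)
  have hstable {t : ℕ} (ht : A (t + 1) = A t) (k : ℕ) : A (t + k) = A t := by
    induction k with
    | zero => rfl
    | succ k ih => ext v; rw [← add_assoc, hA, ih, ← hA, ht]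
  have hcard (t : ℕ) : t ≤ (A t).card ∨ A (t + 1) = A t := by
    induction t with
    | zero => simp
    | succ t ih =>
      rcases eq_or_ne (A (t + 1)) (A t) with h | h
      · exact Or.inr ((hstable h 2).trans h.symm)
      · have hlt := Finset.card_lt_card ((hsucc t).ssubset_of_ne h.symm)
        exact Or.inl (Nat.succ_le_of_lt ((ih.resolve_right h).trans_lt hlt))
  have hfix : A (Fintype.card V + 1) = A (Fintype.card V) := by
    rcases hcard (Fintype.card V) with h | h
    · have huniv := Finset.eq_univ_of_card _ (le_antisymm (Finset.card_le_univ _) h)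
      exact Finset.Subset.antisymm (by rw [huniv]; exact Finset.subset_univ _) (hsucc _)
    · exact h
  apply Finset.Subset.antisymm
  · have hle (t : ℕ) : A t ⊆ activationClosure G (A 0) := by
      induction t with
      | zero => exact subset_activationClosure G _
      | succ t ih =>
        intro v hv
        rcases (hA t v).1 hv with h | h
        · exact ih h
        · exact mem_activationClosure_of_rule hG _ v (hG v ih h)
    exact hle _
  · refine activationClosure_subset ?_ fun v hv => ?_
    · exact monotone_nat_of_le_succ (f := A) hsucc (Nat.zero_le _)
    · rw [← hfix]
      exact (hA _ v).2 (Or.inr hv)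

variable [DecidableEq V]

theorem activationClosure_union {G : V → Finset V → Prop} (hG : ∀ v, Monotone (G v))
    (hunion : ∀ v X Y, G v (X ∪ Y) → G v X ∨ G v Y) (S T : Finset V) :
    activationClosure G (S ∪ T) = activationClosure G S ∪ activationClosure G T := by
  apply Finset.Subset.antisymm
  · refine activationClosure_subset
      (Finset.union_subset_union (subset_activationClosure G S) (subset_activationClosure G T))
      fun v hv => Finset.mem_union.2 ?_
    exact (hunion v _ _ hv).imp (mem_activationClosure_of_rule hG S v)
      (mem_activationClosure_of_rule hG T v)
  · exact Finset.union_subset (activationClosure_mono G Finset.subset_union_left)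
      (activationClosure_mono G Finset.subset_union_right)

/-- The effect of the rule at a single vertex `v` on the closure: it only matters whether `v`
is activated by the closure formed without using the rule at `v`. -/
theorem activationClosure_eq_ite {G : V → Finset V → Prop} (hG : ∀ v, Monotone (G v))
    (S : Finset V) (v : V) :
    activationClosure G S =
      if G v (activationClosure (Function.update G v fun _ => False) S) then
        activationClosure (Function.update G v fun _ => True) S
      else activationClosure (Function.update G v fun _ => False) S := by
  have hmono (P : Prop) (u : V) : Monotone (Function.update G v (fun _ => P) u) := by
    rcases eq_or_ne u v with rfl | hu
    · simpa using monotone_const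
    · simpa [hu] using hG u
  have hlow : activationClosure (Function.update G v fun _ => False) S ⊆
      activationClosure G S := by
    refine activationClosure_mono_rule (fun u X hu => ?_) S
    rcases eq_or_ne u v with rfl | huv
    · simp at hu
    · simpa [huv] using hu
  split_ifs with hv
  · apply Finset.Subset.antisymm
    · refine activationClosure_mono_rule (fun u X hu => ?_) S
      rcases eq_or_ne u v with rfl | huv
      · simp
      · simpa [huv] using hu
    · refine activationClosure_subset (subset_activationClosure G S) fun u hu => ?_
      apply mem_activationClosure_of_rule hG
      rcases eq_or_ne u v with rfl | huv
      · exact hG u hlow hv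
      · simpa [huv] using hu
  · refine Finset.Subset.antisymm
      (activationClosure_subset (subset_activationClosure _ S) fun u hu => ?_) hlow
    rcases eq_or_ne u v with rfl | huv
    · exact absurd hu hv
    · exact mem_activationClosure_of_rule (hmono False) S u (by simpa [huv] using hu)

end Activation

section RandomActivation

variable {V : Type*} [Fintype V] {α : Type*} [MeasurableSpace α]

theorem measurable_activationClosure {β : Type*} [MeasurableSpace β]
    {g : V → Finset V → Set α} (hg : ∀ v X, MeasurableSet (g v X)) (S : Finset V)
    (φ : Finset V → β) :
    Measurable fun ω : V → α => φ (activationClosure (fun v X => ω v ∈ g v X) S) := by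
  have hrule : Measurable fun (ω : V → α) (v : V) (X : Finset V) => ω v ∈ g v X :=
    measurable_pi_lambda _ fun v => measurable_pi_lambda _ fun X =>
      measurableSet_setOfPred.1 (measurable_pi_apply v (hg v X))
  exact (measurable_of_finite fun G : V → Finset V → Prop =>
    φ (activationClosure G S)).comp hrule

theorem lintegral_ite_mem_eq_of_measure_eq {μ : Measure α} [IsFiniteMeasure μ] {s t : Set α}
    (hs : MeasurableSet s) (ht : MeasurableSet t) (h : μ s = μ t) (a b : ENNReal) :
    ∫⁻ w, (if w ∈ s then a else b) ∂μ = ∫⁻ w, (if w ∈ t then a else b) ∂μ := by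
  have key {r : Set α} (hr : MeasurableSet r) :
      ∫⁻ w, (if w ∈ r then a else b) ∂μ = a * μ r + b * μ rᶜ := by
    rw [← lintegral_add_compl _ hr,
      setLIntegral_congr_fun hr (g := fun _ => a) (fun w hw => if_pos hw),
      setLIntegral_congr_fun hr.compl (g := fun _ => b) (fun w hw => if_neg hw),
      setLIntegral_const, setLIntegral_const]
  rw [key hs, key ht, measure_compl hs (measure_ne_top _ _),
    measure_compl ht (measure_ne_top _ _), h]

variable {μ : V → Measure α} [∀ v, IsProbabilityMeasure (μ v)]

theorem integrable_card_activationClosure {g : V → Finset V → Set α}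
    (hg : ∀ v X, MeasurableSet (g v X)) (S : Finset V) :
    Integrable (fun ω : V → α =>
      ((activationClosure (fun u X => ω u ∈ g u X) S).card : ℝ)) (Measure.pi μ) := by
  refine Integrable.of_bound (measurable_activationClosure hg S
    fun T => (T.card : ℝ)).aestronglyMeasurable (Fintype.card V) (ae_of_all _ fun ω => ?_)
  rw [Real.norm_natCast]
  exact_mod_cast Finset.card_le_univ _

variable [DecidableEq V]

theorem lintegral_activationClosure_eq_of_eq_off {g h : V → Finset V → Set α}
    (hg : ∀ v, Monotone (g v)) (hh : ∀ v, Monotone (h v))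
    (hgm : ∀ v X, MeasurableSet (g v X)) (hhm : ∀ v X, MeasurableSet (h v X))
    (v : V) (hoff : ∀ u, u ≠ v → g u = h u) (hμ : ∀ X, μ v (g v X) = μ v (h v X))
    (S : Finset V) (φ : Finset V → ENNReal) :
    ∫⁻ ω, φ (activationClosure (fun u X => ω u ∈ g u X) S) ∂Measure.pi μ =
      ∫⁻ ω, φ (activationClosure (fun u X => ω u ∈ h u X) S) ∂Measure.pi μ := by
  refine lintegral_eq_of_lmarginal_eq {v} (measurable_activationClosure hgm S φ)
    (measurable_activationClosure hhm S φ) ?_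
  rw [lmarginal_singleton, lmarginal_singleton]
  funext x
  have hrule {k : V → Finset V → Set α} (hk : ∀ u, u ≠ v → k u = h u) (w : α)
      (P : Finset V → Prop) :
      Function.update (fun u X => Function.update x v w u ∈ k u X) v P =
        Function.update (fun u X => x u ∈ h u X) v P := by
    funext u
    rcases eq_or_ne u v with rfl | hu
    · simp
    · simp [hu, hk u hu]
  have hite {k : V → Finset V → Set α} (hmono : ∀ u, Monotone (k u))
      (hk : ∀ u, u ≠ v → k u = h u) (w : α) :=
    congrArg φ (activationClosure_eq_ite
      (G := fun u X => Function.update x v w u ∈ k u X)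
      (fun u X Y hXY hX => hmono u hXY hX) S v)
  simp only [hite hg hoff, hite hh (fun _ _ => rfl), hrule hoff, hrule (fun _ _ => rfl),
    Function.update_self, apply_ite φ]
  exact lintegral_ite_mem_eq_of_measure_eq (hgm v _) (hhm v _) (hμ _) _ _

/-- The law of the final active set only depends on the probabilities with which a given vertex
is activated by a given set. -/
theorem lintegral_activationClosure_congr {g h : V → Finset V → Set α}
    (hg : ∀ v, Monotone (g v)) (hh : ∀ v, Monotone (h v))
    (hgm : ∀ v X, MeasurableSet (g v X)) (hhm : ∀ v X, MeasurableSet (h v X))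
    (hμ : ∀ v X, μ v (g v X) = μ v (h v X)) (S : Finset V) (φ : Finset V → ENNReal) :
    ∫⁻ ω, φ (activationClosure (fun u X => ω u ∈ g u X) S) ∂Measure.pi μ =
      ∫⁻ ω, φ (activationClosure (fun u X => ω u ∈ h u X) S) ∂Measure.pi μ := by
  have hybrid (D : Finset V) :
      ∫⁻ ω, φ (activationClosure (fun u X => ω u ∈ g u X) S) ∂Measure.pi μ =
        ∫⁻ ω, φ (activationClosure (fun u X => ω u ∈ D.piecewise h g u X) S) ∂Measure.pi μ := by
    have hmono (D : Finset V) (u : V) : Monotone (D.piecewise h g u) := by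
      by_cases hu : u ∈ D <;> simp [hu, hg u, hh u]
    have hmeas (D : Finset V) (u : V) (X : Finset V) : MeasurableSet (D.piecewise h g u X) := by
      by_cases hu : u ∈ D <;> simp [hu, hgm u X, hhm u X]
    induction D using Finset.induction_on with
    | empty => simp
    | insert v D hv ih =>
      rw [ih]
      refine lintegral_activationClosure_eq_of_eq_off (hmono _) (hmono _) (hmeas _) (hmeas _) v
        (fun u hu => ?_) (fun X => ?_) S φ
      · by_cases huD : u ∈ D <;> simp [huD, hu]
      · rw [Finset.piecewise_eq_of_notMem _ _ _ hv, Finset.piecewise_insert_self, hμ]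
  simpa using hybrid Finset.univ

theorem integral_card_activationClosure_congr {g h : V → Finset V → Set α}
    (hg : ∀ v, Monotone (g v)) (hh : ∀ v, Monotone (h v))
    (hgm : ∀ v X, MeasurableSet (g v X)) (hhm : ∀ v X, MeasurableSet (h v X))
    (hμ : ∀ v X, μ v (g v X) = μ v (h v X)) (S : Finset V) :
    ∫ ω, ((activationClosure (fun u X => ω u ∈ g u X) S).card : ℝ) ∂Measure.pi μ =
      ∫ ω, ((activationClosure (fun u X => ω u ∈ h u X) S).card : ℝ) ∂Measure.pi μ := by
  rw [integral_eq_lintegral_of_nonneg_ae (ae_of_all _ fun _ => Nat.cast_nonneg _)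
      (integrable_card_activationClosure hgm S).aestronglyMeasurable,
    integral_eq_lintegral_of_nonneg_ae (ae_of_all _ fun _ => Nat.cast_nonneg _)
      (integrable_card_activationClosure hhm S).aestronglyMeasurable,
    lintegral_activationClosure_congr hg hh hgm hhm hμ S fun T => ENNReal.ofReal T.card]

/-- If a union activates a vertex only when one of its parts does, the expected size of the final
active set is a monotone and submodular function of the seed set. -/
theorem integral_card_activationClosure_monotone_submodular {g : V → Finset V → Set α}
    (hg : ∀ v, Monotone (g v)) (hgm : ∀ v X, MeasurableSet (g v X))
    (hunion : ∀ v X Y, g v (X ∪ Y) ⊆ g v X ∪ g v Y) :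
    (∀ B C : Finset V, B ⊆ C →
      ∫ ω, ((activationClosure (fun u X => ω u ∈ g u X) B).card : ℝ) ∂Measure.pi μ ≤
        ∫ ω, ((activationClosure (fun u X => ω u ∈ g u X) C).card : ℝ) ∂Measure.pi μ) ∧
    Submodular fun S : Finset V =>
      ∫ ω, ((activationClosure (fun u X => ω u ∈ g u X) S).card : ℝ) ∂Measure.pi μ := by
  have hint := integrable_card_activationClosure (μ := μ) hgm
  constructor
  · intro B C hBC
    refine integral_mono (hint B) (hint C) fun ω => ?_
    exact Nat.cast_le.2 (Finset.card_le_card (activationClosure_mono _ hBC))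
  · intro B C hBC x _
    beta_reduce
    rw [← integral_sub (hint _) (hint _), ← integral_sub (hint _) (hint _)]
    refine integral_mono ((hint _).sub (hint _)) ((hint _).sub (hint _)) fun ω => ?_
    have hins (S : Finset V) :
        ((activationClosure (fun u X => ω u ∈ g u X) (insert x S)).card : ℝ) -
          (activationClosure (fun u X => ω u ∈ g u X) S).card =
        ((activationClosure (fun u X => ω u ∈ g u X) {x} \
          activationClosure (fun u X => ω u ∈ g u X) S).card : ℝ) := by
      rw [Finset.insert_eq, activationClosure_union (G := fun u X => ω u ∈ g u X)
        (fun u X Y hXY hX => hg u hXY hX) (fun u X Y hX => hunion u X Y hX), ← Finset.card_sdiff_add_card]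
      push_cast
      ring
    beta_reduce
    rw [hins, hins]
    exact_mod_cast Finset.card_le_card
      (Finset.sdiff_subset_sdiff subset_rfl (activationClosure_mono _ hBC))

end RandomActivation

/-- Nonnegative weights of total at most one are the lengths of disjoint pieces of `[0, 1]`. -/
theorem exists_measurableSet_measure_iUnion_eq_sum {V : Type*} [Fintype V] (q : V → ℝ)
    (hq : ∀ u, 0 ≤ q u) (hsum : ∑ u, q u ≤ 1) :
    ∃ I : V → Set ℝ, (∀ u, MeasurableSet (I u)) ∧ ∀ X : Finset V,
      volume.restrict (Set.Icc (0 : ℝ) 1) (⋃ u ∈ X, I u) = ENNReal.ofReal (∑ u ∈ X, q u) := by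
  let e := Fintype.equivFin V
  let c : V → ℝ := fun u => ∑ w ∈ Finset.univ.filter (fun w => e w < e u), q w
  have hc (u : V) : 0 ≤ c u := Finset.sum_nonneg fun w _ => hq w
  have hadd (u : V) : c u + q u =
      ∑ w ∈ insert u (Finset.univ.filter (fun w => e w < e u)), q w := by
    rw [Finset.sum_insert (by simp), add_comm]
  have hlt {u w : V} (h : e u < e w) : c u + q u ≤ c w := by
    rw [hadd]
    refine Finset.sum_le_sum_of_subset_of_nonneg (fun z hz => ?_) fun z _ _ => hq z
    simp only [Finset.mem_insert, Finset.mem_filter, Finset.mem_univ, true_and] at hz ⊢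
    rcases hz with rfl | hz
    · exact h
    · exact hz.trans h
  have hone (u : V) : c u + q u ≤ 1 := by
    rw [hadd]
    exact (Finset.sum_le_sum_of_subset_of_nonneg (Finset.subset_univ _)
      fun z _ _ => hq z).trans hsum
  refine ⟨fun u => Set.Ioc (c u) (c u + q u), fun u => measurableSet_Ioc, fun X => ?_⟩
  rw [measure_biUnion_finset _ fun u _ => measurableSet_Ioc,
    ENNReal.ofReal_sum_of_nonneg fun u _ => hq u]
  · refine Finset.sum_congr rfl fun u _ => ?_
    have hsub : Set.Ioc (c u) (c u + q u) ⊆ Set.Icc 0 1 := fun w hw =>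
      ⟨(hc u).trans hw.1.le, hw.2.trans (hone u)⟩
    rw [Measure.restrict_eq_self _ hsub, Real.volume_Ioc, add_sub_cancel_left]
  · intro u _ w _ huw
    refine Set.disjoint_left.2 fun z hz hz' => ?_
    rcases lt_or_gt_of_ne (e.injective.ne huw) with h | h
    · exact absurd (hz.2.trans (hlt h)) (not_le.2 hz'.1)
    · exact absurd (hz'.2.trans (hlt h)) (not_le.2 hz.1)

/-- The Linear Threshold influence spread, the expectation over independent uniform
thresholds of the size of the final active set, is monotone and submodular. -/
theorem ltSpread_monotone_submodular {V : Type*} [Fintype V] [DecidableEq V]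
    (E : Finset (V × V)) (p : V × V → ℝ)
    (hp0 : ∀ e ∈ E, 0 ≤ p e) (hp1 : ∀ e ∈ E, p e ≤ 1)
    (hin : ∀ v : V, ∑ u ∈ Finset.univ.filter (fun u => (u, v) ∈ E), p (u, v) ≤ 1)
    -- the Linear Threshold activation dynamics, for seed set `S` and thresholds `θ`
    (A : Finset V → (V → ℝ) → ℕ → Finset V)
    (hA0 : ∀ (S : Finset V) (θ : V → ℝ), A S θ 0 = S)
    (hAstep : ∀ (S : Finset V) (θ : V → ℝ) (t : ℕ),
      A S θ (t + 1) = A S θ t ∪ Finset.univ.filter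
        (fun v => θ v ≤ ∑ u ∈ (A S θ t).filter (fun u => (u, v) ∈ E), p (u, v)))
    -- the influence spread: expected size of the final active set under independent
    -- uniform `[0,1]` thresholds
    (σLT : Finset V → ℝ)
    (hσ : ∀ S : Finset V,
      σLT S = ∫ θ : V → ℝ, ((A S θ (Fintype.card V)).card : ℝ)
        ∂(Measure.pi fun _ : V => volume.restrict (Set.Icc (0 : ℝ) 1))) :
    (∀ B C : Finset V, B ⊆ C → σLT B ≤ σLT C) ∧ Submodular σLT := by
  let q : V → V → ℝ := fun v u => if (u, v) ∈ E then p (u, v) else 0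
  have hq (v u : V) : 0 ≤ q v u := by
    by_cases h : (u, v) ∈ E
    · simpa [q, h] using hp0 _ h
    · simp [q, h]
  have hqsum (v : V) : ∑ u, q v u ≤ 1 := by
    simpa [q, Finset.sum_filter] using hin v
  have hqmono (v : V) : Monotone fun X : Finset V => ∑ u ∈ X, q v u := fun X Y hXY =>
    Finset.sum_le_sum_of_subset_of_nonneg hXY fun u _ _ => hq v u
  choose I hIm hI using fun v => exists_measurableSet_measure_iUnion_eq_sum (q v) (hq v) (hqsum v)
  let g : V → Finset V → Set ℝ := fun v X => Set.Iic (∑ u ∈ X, q v u)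
  let h : V → Finset V → Set ℝ := fun v X => ⋃ u ∈ X, I v u
  have hg (v : V) : Monotone (g v) := fun X Y hXY => Set.Iic_subset_Iic.2 (hqmono v hXY)
  have hh (v : V) : Monotone (h v) := fun X Y hXY =>
    Set.biUnion_subset_biUnion_left fun _ hu => hXY hu
  have hgm (v : V) (X : Finset V) : MeasurableSet (g v X) := measurableSet_Iic
  have hhm (v : V) (X : Finset V) : MeasurableSet (h v X) :=
    X.measurableSet_biUnion fun u _ => hIm v u
  have hμ (v : V) (X : Finset V) :
      volume.restrict (Set.Icc (0 : ℝ) 1) (g v X) =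
        volume.restrict (Set.Icc (0 : ℝ) 1) (h v X) := by
    have hle : ∑ u ∈ X, q v u ≤ 1 := (hqmono v (Finset.subset_univ X)).trans (hqsum v)
    have hinter : Set.Iic (∑ u ∈ X, q v u) ∩ Set.Icc 0 1 = Set.Icc 0 (∑ u ∈ X, q v u) := by
      ext w
      simp only [Set.mem_inter_iff, Set.mem_Iic, Set.mem_Icc]
      exact ⟨fun hw => ⟨hw.2.1, hw.1⟩, fun hw => ⟨hw.2, hw.1, hw.2.trans hle⟩⟩
    rw [hI v X, Measure.restrict_apply (hgm v X), hinter, Real.volume_Icc, sub_zero]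
  have hunion (v : V) (X Y : Finset V) : h v (X ∪ Y) ⊆ h v X ∪ h v Y := by
    simp only [h, Finset.set_biUnion_union, subset_rfl]
  have hfinal (S : Finset V) (θ : V → ℝ) :
      A S θ (Fintype.card V) = activationClosure (fun v X => θ v ∈ g v X) S := by
    have := eq_activationClosure_of_step (G := fun v X => θ v ∈ g v X) (A := A S θ)
      (fun v X Y hXY hX => hg v hXY hX) fun t v => by
        simp [hAstep, g, q, Finset.sum_filter]
    rwa [hA0] at this
  have : IsProbabilityMeasure (volume.restrict (Set.Icc (0 : ℝ) 1)) := ⟨by simp⟩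
  have hσ' : σLT = fun S => ∫ θ : V → ℝ,
      ((activationClosure (fun v X => θ v ∈ h v X) S).card : ℝ)
        ∂(Measure.pi fun _ : V => volume.restrict (Set.Icc (0 : ℝ) 1)) := by
    funext S
    rw [hσ, ← integral_card_activationClosure_congr hg hh hgm hhm hμ S]
    simp only [hfinal]
  rw [hσ']
  exact integral_card_activationClosure_monotone_submodular hh hhm hunion
end

section
/- Let V be a finite set of vertices and E ⊆ V × V a set of directed edges, and let p, q : E → [0,1] satisfy p(e) ≤ q(e) for every e ∈ E. Then for every seed set S ⊆ V, σ_p(S) ≤ σ_q(S): the Independent Cascade influence spread is a monotone function of the edge probabilities. -/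
open scoped Classical

/-- The weighted sum of `f` over `𝒫 (insert a s)` with product weights is the convex combination,
with coefficients `1 - p a` and `p a`, of the sums over `𝒫 s` of `f` and `f ∘ insert a`. -/
theorem sum_powerset_insert_prod_mul {α : Type*} [DecidableEq α] {a : α} {s : Finset α}
    (ha : a ∉ s) (p : α → ℝ) (f : Finset α → ℝ) :
    ∑ t ∈ (insert a s).powerset, ((∏ e ∈ t, p e) * ∏ e ∈ insert a s \ t, (1 - p e)) * f t =
      (1 - p a) * ∑ t ∈ s.powerset, ((∏ e ∈ t, p e) * ∏ e ∈ s \ t, (1 - p e)) * f t +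
      p a * ∑ t ∈ s.powerset, ((∏ e ∈ t, p e) * ∏ e ∈ s \ t, (1 - p e)) * f (insert a t) := by
  rw [Finset.sum_powerset_insert ha, Finset.mul_sum, Finset.mul_sum]
  congr 1 <;> refine Finset.sum_congr rfl fun t ht => ?_
  all_goals have hat : a ∉ t := fun h => ha (Finset.mem_powerset.1 ht h)
  · rw [Finset.insert_sdiff_of_notMem _ hat,
      Finset.prod_insert fun h => ha (Finset.mem_sdiff.1 h).1]
    ring
  · have hsdiff : insert a s \ insert a t = s \ t := by
      ext x
      simp only [Finset.mem_sdiff, Finset.mem_insert]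
      grind
    rw [hsdiff, Finset.prod_insert hat]
    ring

/-- The expectation of a monotone set function under independent inclusion of the elements of `s`
is monotone in the inclusion probabilities. -/
theorem sum_powerset_prod_mul_le_of_monotone {α : Type*} [DecidableEq α] (s : Finset α)
    {p q : α → ℝ} (hp0 : ∀ e ∈ s, 0 ≤ p e) (hq1 : ∀ e ∈ s, q e ≤ 1) (hpq : ∀ e ∈ s, p e ≤ q e)
    {f : Finset α → ℝ} (hf : Monotone f) :
    ∑ t ∈ s.powerset, ((∏ e ∈ t, p e) * ∏ e ∈ s \ t, (1 - p e)) * f t ≤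
      ∑ t ∈ s.powerset, ((∏ e ∈ t, q e) * ∏ e ∈ s \ t, (1 - q e)) * f t := by
  induction s using Finset.induction_on generalizing f with
  | empty => simp
  | insert a s ha ih =>
    simp only [Finset.forall_mem_insert] at hp0 hq1 hpq
    rw [sum_powerset_insert_prod_mul ha, sum_powerset_insert_prod_mul ha]
    have h₁ := ih hp0.2 hq1.2 hpq.2 hf
    have h₂ := ih hp0.2 hq1.2 hpq.2 (f := fun t => f (insert a t))
      fun _ _ h => hf (Finset.insert_subset_insert a h)
    have h₃ : ∑ t ∈ s.powerset, ((∏ e ∈ t, q e) * ∏ e ∈ s \ t, (1 - q e)) * f t ≤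
        ∑ t ∈ s.powerset, ((∏ e ∈ t, q e) * ∏ e ∈ s \ t, (1 - q e)) * f (insert a t) := by
      refine Finset.sum_le_sum fun t ht => mul_le_mul_of_nonneg_left
        (hf (Finset.subset_insert a t)) (mul_nonneg ?_ ?_)
      · exact Finset.prod_nonneg fun e he =>
          (hp0.2 e (Finset.mem_powerset.1 ht he)).trans (hpq.2 e (Finset.mem_powerset.1 ht he))
      · exact Finset.prod_nonneg fun e he => sub_nonneg.2 (hq1.2 e (Finset.mem_sdiff.1 he).1)
    have h₄ := mul_le_mul_of_nonneg_left h₁ (sub_nonneg.2 (hpq.1.trans hq1.1))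
    have h₅ := mul_le_mul_of_nonneg_left h₂ hp0.1
    have h₆ := mul_le_mul_of_nonneg_left h₃ (sub_nonneg.2 hpq.1)
    linarith

theorem reachSet_mono_left {V : Type*} [Fintype V] (S : Finset V) :
    Monotone fun H : Finset (V × V) => reachSet H S := by
  intro H K hHK v hv
  simp only [reachSet, Finset.mem_filter, Finset.mem_univ, true_and] at hv ⊢
  obtain ⟨s, hs, hsv⟩ := hv
  exact ⟨s, hs, Relation.ReflTransGen.mono (fun _ _ h => hHK h) _ _ hsv⟩

/-- The Independent Cascade influence spread is a monotone function of the edge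
probabilities: if `p(e) ≤ q(e)` on every edge then `σ_p(S) ≤ σ_q(S)` for every seed
set `S`. -/
theorem icSpread_monotone_in_probabilities {V : Type*} [Fintype V] [DecidableEq V]
    (E : Finset (V × V)) (p q : V × V → ℝ)
    (hp0 : ∀ e ∈ E, 0 ≤ p e) (hp1 : ∀ e ∈ E, p e ≤ 1)
    (hq0 : ∀ e ∈ E, 0 ≤ q e) (hq1 : ∀ e ∈ E, q e ≤ 1)
    (hpq : ∀ e ∈ E, p e ≤ q e) :
    ∀ S : Finset V, icSpread E p S ≤ icSpread E q S := by
  intro S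
  exact sum_powerset_prod_mul_le_of_monotone E hp0 hq1 hpq
    fun _ _ h => Nat.cast_le.2 (Finset.card_le_card (reachSet_mono_left S h))
end

section
/- Let V be a finite set of vertices with |V| = n, E ⊆ V × V, and p : E → [0,1]. For H ⊆ E and u ∈ V define the reverse reachable set RR_H(u) = {v ∈ V : u ∈ R_H({v})}. Then for every S ⊆ V, ∑_{u ∈ V} ∑_{H ⊆ E} w_p(H) · 𝟙[S ∩ RR_H(u) ≠ ∅] = σ_p(S). Equivalently, if u is chosen uniformly at random from V and each edge e is independently live with probability p(e), then the probability that S intersects the reverse reachable set of u equals σ_p(S) / n. -/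
open scoped Classical

/-- The reverse reachable set of `u` in the live-edge graph `H`: all vertices `v` such
that `u` is reachable from `v` using only edges of `H`. -/
noncomputable def rrSet {V : Type*} [Fintype V]
    (H : Finset (V × V)) (u : V) : Finset V :=
  Finset.univ.filter (fun v => u ∈ reachSet H {v})

theorem inter_rrSet_nonempty_iff {V : Type*} [Fintype V] [DecidableEq V]
    (H : Finset (V × V)) (S : Finset V) (u : V) :
    (S ∩ rrSet H u).Nonempty ↔ u ∈ reachSet H S := by
  simp [Finset.Nonempty, rrSet, reachSet]

/-- The key identity underlying reverse-reachable-set (polling) algorithms: summing,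
over vertices `u` and live-edge graphs `H`, the weight of `H` times the indicator that
the seed set `S` intersects the reverse reachable set of `u`, gives exactly the
Independent Cascade influence spread `σ_p(S)`. -/
theorem rrSet_polling_identity {V : Type*} [Fintype V] [DecidableEq V]
    (E : Finset (V × V)) (p : V × V → ℝ)
    (hp0 : ∀ e ∈ E, 0 ≤ p e) (hp1 : ∀ e ∈ E, p e ≤ 1) :
    ∀ S : Finset V,
      (∑ u : V, ∑ H ∈ E.powerset,
          liveEdgeWeight E p H * (if (S ∩ rrSet H u).Nonempty then (1 : ℝ) else 0)) =
        icSpread E p S := by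
  intro S
  rw [Finset.sum_comm, icSpread]
  refine Finset.sum_congr rfl fun H _ => ?_
  rw [← Finset.mul_sum]
  simp [inter_rrSet_nonempty_iff]
end
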